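/- Soundness: if an AK formula φ is provable in the tableau calculus T_AK, then φ is AK-valid. -/

import Mathlib

/- Agent-knowledge logic, language with primitive ∨, ◇_A, ◇_K (used for
   negation normal forms in the tableau calculus T_AK). -/
inductive AKForm (PA PK NA NK : Type) : Type
  | propA : PA → AKForm PA PK NA NK
  | propK : PK → AKForm PA PK NA NK
  | nomA  : NA → AKForm PA PK NA NK
  | nomK  : NK → AKForm PA PK NA NK
  | neg   : AKForm PA PK NA NK → AKForm PA PK NA NK
  | and   : AKForm PA PK NA NK → AKForm PA PK NA NK → AKForm PA PK NA NK
  | or    : AKForm PA PK NA NK → AKForm PA PK NA NK → AKForm PA PK NA NK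
  | boxA  : AKForm PA PK NA NK → AKForm PA PK NA NK
  | boxK  : AKForm PA PK NA NK → AKForm PA PK NA NK
  | diaA  : AKForm PA PK NA NK → AKForm PA PK NA NK
  | diaK  : AKForm PA PK NA NK → AKForm PA PK NA NK
  | atA   : NA → AKForm PA PK NA NK → AKForm PA PK NA NK
  | atK   : NK → AKForm PA PK NA NK → AKForm PA PK NA NK

variable {PA PK NA NK : Type}

/-- Occurrence of an A-nominal in a formula. -/
def occA (b : NA) : AKForm PA PK NA NK → Prop
  | .propA _ => False
  | .propK _ => False
  | .nomA a => a = b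
  | .nomK _ => False
  | .neg φ => occA b φ
  | .and φ ψ => occA b φ ∨ occA b ψ
  | .or φ ψ => occA b φ ∨ occA b ψ
  | .boxA φ => occA b φ
  | .boxK φ => occA b φ
  | .diaA φ => occA b φ
  | .diaK φ => occA b φ
  | .atA a φ => a = b ∨ occA b φ
  | .atK _ φ => occA b φ

/-- Occurrence of a K-nominal in a formula. -/
def occK (l : NK) : AKForm PA PK NA NK → Prop
  | .propA _ => False
  | .propK _ => False
  | .nomA _ => False
  | .nomK k => k = l
  | .neg φ => occK l φ
  | .and φ ψ => occK l φ ∨ occK l ψ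
  | .or φ ψ => occK l φ ∨ occK l ψ
  | .boxA φ => occK l φ
  | .boxK φ => occK l φ
  | .diaA φ => occK l φ
  | .diaK φ => occK l φ
  | .atA _ φ => occK l φ
  | .atK k φ => k = l ∨ occK l φ

/-- Complexity `|φ|` of a formula. -/
def fsize : AKForm PA PK NA NK → ℕ
  | .propA _ => 1
  | .propK _ => 1
  | .nomA _ => 1
  | .nomK _ => 1
  | .neg φ => fsize φ + 1
  | .and φ ψ => fsize φ + fsize ψ + 1
  | .or φ ψ => fsize φ + fsize ψ + 1
  | .boxA φ => fsize φ + 1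
  | .boxK φ => fsize φ + 1
  | .diaA φ => fsize φ + 1
  | .diaK φ => fsize φ + 1
  | .atA _ φ => fsize φ + 1
  | .atK _ φ => fsize φ + 1

/-- Negation normal form: negation is applied to atoms only. -/
def IsNNF : AKForm PA PK NA NK → Prop
  | .neg (.propA _) => True
  | .neg (.propK _) => True
  | .neg (.nomA _) => True
  | .neg (.nomK _) => True
  | .neg _ => False
  | .and φ ψ => IsNNF φ ∧ IsNNF ψ
  | .or φ ψ => IsNNF φ ∧ IsNNF ψ
  | .boxA φ => IsNNF φ
  | .boxK φ => IsNNF φ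
  | .diaA φ => IsNNF φ
  | .diaK φ => IsNNF φ
  | .atA _ φ => IsNNF φ
  | .atK _ φ => IsNNF φ
  | _ => True

/-- Entries occurring on a tableau branch: a prefixed formula `@_a @_k φ`, either an
    ordinary one (`form`), or an accessibility formula `@_a @_k ◇_A b`
    (resp. `@_a @_k ◇_K l`) introduced by the ◇_A-rule (resp. ◇_K-rule) with fresh
    nominal `b` (resp. `l`) applied to the premise `@_a @_k ◇_A φ` (resp. `@_a @_k ◇_K φ`). -/
inductive Entry (PA PK NA NK : Type) : Type
  | form : NA → NK → AKForm PA PK NA NK → Entry PA PK NA NK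
  | accA : NA → NK → NA → AKForm PA PK NA NK → Entry PA PK NA NK
  | accK : NA → NK → NK → AKForm PA PK NA NK → Entry PA PK NA NK

/-- The prefixed formula carried by an entry. -/
def Entry.pf : Entry PA PK NA NK → NA × NK × AKForm PA PK NA NK
  | .form a k φ => (a, k, φ)
  | .accA a k b _ => (a, k, .diaA (.nomA b))
  | .accK a k l _ => (a, k, .diaK (.nomK l))

/-- Occurrence of an A-nominal in an entry. -/
def Entry.hasNomA (b : NA) : Entry PA PK NA NK → Prop
  | .form a _ φ => a = b ∨ occA b φ
  | .accA a _ c φ => a = b ∨ c = b ∨ occA b φ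
  | .accK a _ _ φ => a = b ∨ occA b φ

/-- Occurrence of a K-nominal in an entry. -/
def Entry.hasNomK (l : NK) : Entry PA PK NA NK → Prop
  | .form _ k φ => k = l ∨ occK l φ
  | .accA _ k _ φ => k = l ∨ occK l φ
  | .accK _ k m φ => k = l ∨ m = l ∨ occK l φ

/-- The prefixed formula `@_a @_k φ` occurs in the list of entries `es`. -/
def pfMem (es : List (Entry PA PK NA NK)) (a : NA) (k : NK) (φ : AKForm PA PK NA NK) :
    Prop :=
  ∃ e ∈ es, e.pf = (a, k, φ)

def nomAOn (es : List (Entry PA PK NA NK)) (b : NA) : Prop := ∃ e ∈ es, e.hasNomA b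

def nomKOn (es : List (Entry PA PK NA NK)) (l : NK) : Prop := ∃ e ∈ es, e.hasNomK l

/-- One application of a non-branching rule of T_AK to the branch `es`:
    the batch of entries it adds, together with all side conditions. -/
inductive Ext1 (es : List (Entry PA PK NA NK)) : List (Entry PA PK NA NK) → Prop
  | refA {a k} : nomAOn es a → nomKOn es k →
      Ext1 es [.form a k (.nomA a)]
  | refK {a k} : nomAOn es a → nomKOn es k →
      Ext1 es [.form a k (.nomK k)]
  | negneg {a k φ} : pfMem es a k (.neg (.neg φ)) →
      Ext1 es [.form a k φ]
  | and {a k φ ψ} : pfMem es a k (.and φ ψ) →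
      Ext1 es [.form a k φ, .form a k ψ]
  | diaA {a k φ b} : Entry.form a k (.diaA φ) ∈ es →
      ¬ nomAOn es b → (¬ ∃ b', Entry.accA a k b' φ ∈ es) →
      Ext1 es [.accA a k b φ, .form b k φ]
  | diaK {a k φ l} : Entry.form a k (.diaK φ) ∈ es →
      ¬ nomKOn es l → (¬ ∃ l', Entry.accK a k l' φ ∈ es) →
      Ext1 es [.accK a k l φ, .form a l φ]
  | boxA {a k φ b ψ} : pfMem es a k (.boxA φ) → Entry.accA a k b ψ ∈ es →
      Ext1 es [.form b k φ]
  | boxK {a k φ l ψ} : pfMem es a k (.boxK φ) → Entry.accK a k l ψ ∈ es →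
      Ext1 es [.form a l φ]
  | atA {a k b φ} : pfMem es a k (.atA b φ) →
      Ext1 es [.form b k φ]
  | atK {a k l φ} : pfMem es a k (.atK l φ) →
      Ext1 es [.form a l φ]
  | idA {a k b φ} : pfMem es a k (.nomA b) → Entry.form a k φ ∈ es →
      Ext1 es [.form b k φ]
  | idK {a k l φ} : pfMem es a k (.nomK l) → Entry.form a k φ ∈ es →
      Ext1 es [.form a l φ]

/-- One rule application on a branch: a non-branching rule, or the choice of one
    disjunct when the (branching) ∨-rule is applied. -/
def BStep (es batch : List (Entry PA PK NA NK)) : Prop :=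
  Ext1 es batch ∨
    ∃ a k φ ψ, pfMem es a k (.or φ ψ) ∧
      (batch = [Entry.form a k φ] ∨ batch = [Entry.form a k ψ])

/-- The closure conditions of Definition of closed branches. -/
def ClosedL (es : List (Entry PA PK NA NK)) : Prop :=
  (∃ a k l p, pfMem es a k (.propA p) ∧ pfMem es a l (.neg (.propA p))) ∨
  (∃ a b k p, pfMem es a k (.propK p) ∧ pfMem es b k (.neg (.propK p))) ∨
  (∃ a b k l, pfMem es a k (.nomA b) ∧ pfMem es a l (.neg (.nomA b))) ∨
  (∃ a b k l, pfMem es a k (.nomK l) ∧ pfMem es b k (.neg (.nomK l)))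

/-- The raw data of a branch of a T_AK tableau: the root formula `@_a @_k φ`
    (in NNF, with `a`, `k` not occurring in `φ`) and a (finite or infinite)
    sequence of batches of entries added by successive rule applications;
    `batches n = none` means the branch has already ended before stage `n`. -/
structure PreBranch (PA PK NA NK : Type) : Type where
  rootA : NA
  rootK : NK
  rootF : AKForm PA PK NA NK
  batches : ℕ → Option (List (Entry PA PK NA NK))

/-- The entries present on the branch after `n` stages. -/
def PreBranch.upTo (Θ : PreBranch PA PK NA NK) : ℕ → List (Entry PA PK NA NK)
  | 0 => [Entry.form Θ.rootA Θ.rootK Θ.rootF]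
  | n + 1 => Θ.upTo n ++ (Θ.batches n).getD []

/-- A branch (maximal path) of a tableau of the calculus T_AK. -/
structure Branch (PA PK NA NK : Type) extends PreBranch PA PK NA NK : Type where
  rootNNF : IsNNF rootF
  rootFreshA : ¬ occA rootA rootF
  rootFreshK : ¬ occK rootK rootF
  dom : ∀ n, batches n = none → batches (n + 1) = none
  steps : ∀ n b, batches n = some b → BStep (toPreBranch.upTo n) b
  /-- rule applications that add no new prefixed formula are disallowed -/
  progress : ∀ n b, batches n = some b →
    ∃ e ∈ b, ¬ ∃ e' ∈ toPreBranch.upTo n, Entry.pf e' = Entry.pf e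
  /-- a closed branch is never extended -/
  notClosed : ∀ n b, batches n = some b → ¬ ClosedL (toPreBranch.upTo n)
  /-- maximality: a branch only ends when it is closed or cannot be properly extended -/
  maximal : ∀ n, batches n = none →
    ClosedL (toPreBranch.upTo n) ∨
      ∀ batch, BStep (toPreBranch.upTo n) batch →
        ∀ e ∈ batch, ∃ e' ∈ toPreBranch.upTo n, Entry.pf e' = Entry.pf e

/-- An entry occurs on the branch. -/
def Branch.Mem (Θ : Branch PA PK NA NK) (e : Entry PA PK NA NK) : Prop :=
  ∃ n, e ∈ Θ.upTo n

/-- The prefixed formula `@_a @_k φ` occurs on the branch (`@_a @_k φ ∈ Θ`). -/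
def Branch.Has (Θ : Branch PA PK NA NK) (a : NA) (k : NK) (φ : AKForm PA PK NA NK) :
    Prop :=
  ∃ e, Θ.Mem e ∧ e.pf = (a, k, φ)

/-- `@_a @_k φ` occurs on the branch as a non-accessibility formula. -/
def Branch.MemForm (Θ : Branch PA PK NA NK) (a : NA) (k : NK)
    (φ : AKForm PA PK NA NK) : Prop :=
  Θ.Mem (Entry.form a k φ)

/-- The A-nominal `b` occurs on the branch. -/
def Branch.NomAOn (Θ : Branch PA PK NA NK) (b : NA) : Prop :=
  ∃ e, Θ.Mem e ∧ e.hasNomA b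

/-- The K-nominal `l` occurs on the branch. -/
def Branch.NomKOn (Θ : Branch PA PK NA NK) (l : NK) : Prop :=
  ∃ e, Θ.Mem e ∧ e.hasNomK l

/-- The branch has infinite length. -/
def Branch.InfiniteLen (Θ : Branch PA PK NA NK) : Prop :=
  ∀ n, Θ.batches n ≠ none

/-- The branch is closed. -/
def Branch.Closed (Θ : Branch PA PK NA NK) : Prop := ∃ n, ClosedL (Θ.upTo n)

/-- The generation relation `(a,k) ≺_Θ (b,l)`: either `k = l` and `b` was introduced
    by applying the ◇_A-rule to a formula `@_a @_k ◇_A φ` on `Θ`, or `a = b` and `l`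
    was introduced by applying the ◇_K-rule to a formula `@_a @_k ◇_K φ` on `Θ`. -/
def Branch.Gen (Θ : Branch PA PK NA NK) (p q : NA × NK) : Prop :=
  (p.2 = q.2 ∧ ∃ φ, Θ.Mem (Entry.accA p.1 p.2 q.1 φ)) ∨
  (p.1 = q.1 ∧ ∃ φ, Θ.Mem (Entry.accK p.1 p.2 q.2 φ))

/- AK models and the AK semantics (extended to the primitives ∨, ◇_A, ◇_K). -/
structure AKModel (PA PK NA NK : Type) where
  WA : Type
  WK : Type
  neWA : Nonempty WA
  neWK : Nonempty WK
  R : WK → WA → WA → Prop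
  S : WA → WK → WK → Prop
  VA : PA → Set WA
  VK : PK → Set WK
  nA : NA → WA
  nK : NK → WK

def AKSat (M : AKModel PA PK NA NK) : M.WA → M.WK → AKForm PA PK NA NK → Prop
  | x, _, .propA p => x ∈ M.VA p
  | _, y, .propK p => y ∈ M.VK p
  | x, _, .nomA a => x = M.nA a
  | _, y, .nomK k => y = M.nK k
  | x, y, .neg φ => ¬ AKSat M x y φ
  | x, y, .and φ ψ => AKSat M x y φ ∧ AKSat M x y ψ
  | x, y, .or φ ψ => AKSat M x y φ ∨ AKSat M x y ψ
  | x, y, .boxA φ => ∀ x', M.R y x x' → AKSat M x' y φ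
  | x, y, .boxK φ => ∀ y', M.S x y y' → AKSat M x y' φ
  | x, y, .diaA φ => ∃ x', M.R y x x' ∧ AKSat M x' y φ
  | x, y, .diaK φ => ∃ y', M.S x y y' ∧ AKSat M x y' φ
  | x, y, .atA a φ => AKSat M (M.nA a) y φ
  | x, y, .atK k φ => AKSat M x (M.nK k) φ

def AKValid (φ : AKForm PA PK NA NK) : Prop :=
  ∀ (M : AKModel PA PK NA NK) (x : M.WA) (y : M.WK), AKSat M x y φ

/-- Negation normal form: `nnf false φ` is an NNF of `φ`, and `nnf true φ` is an
    NNF of `¬φ`. -/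
def nnf : Bool → AKForm PA PK NA NK → AKForm PA PK NA NK
  | false, .propA p => .propA p
  | false, .propK p => .propK p
  | false, .nomA a => .nomA a
  | false, .nomK k => .nomK k
  | false, .neg φ => nnf true φ
  | false, .and φ ψ => .and (nnf false φ) (nnf false ψ)
  | false, .or φ ψ => .or (nnf false φ) (nnf false ψ)
  | false, .boxA φ => .boxA (nnf false φ)
  | false, .boxK φ => .boxK (nnf false φ)
  | false, .diaA φ => .diaA (nnf false φ)
  | false, .diaK φ => .diaK (nnf false φ)
  | false, .atA a φ => .atA a (nnf false φ)
  | false, .atK k φ => .atK k (nnf false φ)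
  | true, .propA p => .neg (.propA p)
  | true, .propK p => .neg (.propK p)
  | true, .nomA a => .neg (.nomA a)
  | true, .nomK k => .neg (.nomK k)
  | true, .neg φ => nnf false φ
  | true, .and φ ψ => .or (nnf true φ) (nnf true ψ)
  | true, .or φ ψ => .and (nnf true φ) (nnf true ψ)
  | true, .boxA φ => .diaA (nnf true φ)
  | true, .boxK φ => .diaK (nnf true φ)
  | true, .diaA φ => .boxA (nnf true φ)
  | true, .diaK φ => .boxK (nnf true φ)
  | true, .atA a φ => .atA a (nnf true φ)
  | true, .atK k φ => .atK k (nnf true φ)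

/-- `Closes es`: the list of prefixed formulas `es` can be expanded, by the rules of
    T_AK, into a closed (sub)tableau: either `es` is already closed, or a
    non-branching rule leads to a closed tableau, or the ∨-rule does so on
    both of its branches. -/
inductive Closes : List (Entry PA PK NA NK) → Prop
  | closed {es} : ClosedL es → Closes es
  | step {es b} : Ext1 es b → Closes (es ++ b) → Closes es
  | split {es a k φ ψ} : pfMem es a k (.or φ ψ) →
      Closes (es ++ [Entry.form a k φ]) → Closes (es ++ [Entry.form a k ψ]) →
      Closes es

/-- `φ` is provable in T_AK: there is a closed tableau whose root formula is
    `@_a @_k φ'`, where `φ'` is an NNF of `¬φ` and `a`, `k` do not occur in `φ`. -/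
def Provable (φ : AKForm PA PK NA NK) : Prop :=
  ∃ (a : NA) (k : NK), ¬ occA a φ ∧ ¬ occK k φ ∧
    Closes [Entry.form a k (nnf true φ)]

/-- The model `M` with its nominals reassigned. -/
abbrev AKModel.rename (M : AKModel PA PK NA NK) (f : NA → M.WA) (g : NK → M.WK) :
    AKModel PA PK NA NK :=
  { M with nA := f, nK := g }

theorem sat_rename (M : AKModel PA PK NA NK) (f : NA → M.WA) (g : NK → M.WK)
    (φ : AKForm PA PK NA NK) (hf : ∀ b, occA b φ → f b = M.nA b)
    (hg : ∀ l, occK l φ → g l = M.nK l) (x : M.WA) (y : M.WK) :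
    AKSat (M.rename f g) x y φ ↔ AKSat M x y φ := by
  induction φ generalizing x y with
  | propA p | propK p => exact Iff.rfl
  | nomA a => simp [AKSat, hf a rfl]
  | nomK k => simp [AKSat, hg k rfl]
  | neg φ ih => exact not_congr (ih hf hg x y)
  | and φ ψ ih₁ ih₂ =>
    exact and_congr
      (ih₁ (fun b h => hf b (.inl h)) (fun l h => hg l (.inl h)) x y)
      (ih₂ (fun b h => hf b (.inr h)) (fun l h => hg l (.inr h)) x y)
  | or φ ψ ih₁ ih₂ =>
    exact or_congr
      (ih₁ (fun b h => hf b (.inl h)) (fun l h => hg l (.inl h)) x y)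
      (ih₂ (fun b h => hf b (.inr h)) (fun l h => hg l (.inr h)) x y)
  | boxA φ ih => exact forall_congr' fun x' => imp_congr_right fun _ => ih hf hg x' y
  | boxK φ ih => exact forall_congr' fun y' => imp_congr_right fun _ => ih hf hg x y'
  | diaA φ ih => exact exists_congr fun x' => and_congr_right fun _ => ih hf hg x' y
  | diaK φ ih => exact exists_congr fun y' => and_congr_right fun _ => ih hf hg x y'
  | atA a φ ih =>
    have h := ih (fun b h => hf b (.inr h)) hg (f a) y
    rw [hf a (.inl rfl)] at h
    simpa only [AKSat, hf a (.inl rfl)] using h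
  | atK k φ ih =>
    have h := ih hf (fun l h => hg l (.inr h)) x (g k)
    rw [hg k (.inl rfl)] at h
    simpa only [AKSat, hg k (.inl rfl)] using h

theorem sat_nnf (M : AKModel PA PK NA NK) (φ : AKForm PA PK NA NK) (x : M.WA) (y : M.WK) :
    (AKSat M x y (nnf false φ) ↔ AKSat M x y φ) ∧
      (AKSat M x y (nnf true φ) ↔ ¬ AKSat M x y φ) := by
  induction φ generalizing x y with
  | and φ ψ ih₁ ih₂ =>
    simp only [nnf, AKSat, ih₁, ih₂, true_and]
    tauto
  | _ => simp_all [nnf, AKSat]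

/-- Truth of a prefixed formula in a model. -/
def Entry.Sat (M : AKModel PA PK NA NK) (e : Entry PA PK NA NK) : Prop :=
  AKSat M (M.nA e.pf.1) (M.nK e.pf.2.1) e.pf.2.2

theorem Entry.Sat.rename {M : AKModel PA PK NA NK} {e : Entry PA PK NA NK} (h : e.Sat M)
    (f : NA → M.WA) (g : NK → M.WK) (hf : ∀ b, e.hasNomA b → f b = M.nA b)
    (hg : ∀ l, e.hasNomK l → g l = M.nK l) : e.Sat (M.rename f g) := by
  have key : ∀ a k φ, e.pf = (a, k, φ) → (e.hasNomA a ∧ ∀ b, occA b φ → e.hasNomA b) →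
      (e.hasNomK k ∧ ∀ l, occK l φ → e.hasNomK l) → e.Sat (M.rename f g) := by
    intro a k φ he hA hK
    simp only [Entry.Sat, he] at h ⊢
    rw [hf a hA.1, hg k hK.1]
    exact (sat_rename M f g φ (fun b hb => hf b (hA.2 b hb))
      (fun l hl => hg l (hK.2 l hl)) _ _).2 h
  cases e <;> refine key _ _ _ rfl ?_ ?_ <;> simp +contextual [hasNomA, hasNomK, occA, occK]

theorem pfMem.sat {M : AKModel PA PK NA NK} {es : List (Entry PA PK NA NK)} {a : NA} {k : NK}
    {φ : AKForm PA PK NA NK} (h : pfMem es a k φ) (hM : ∀ e ∈ es, e.Sat M) :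
    AKSat M (M.nA a) (M.nK k) φ := by
  obtain ⟨e, he, hpf⟩ := h
  simpa [Entry.Sat, hpf] using hM e he

theorem ClosedL.not_sat {es : List (Entry PA PK NA NK)} (h : ClosedL es)
    (M : AKModel PA PK NA NK) : ¬ ∀ e ∈ es, e.Sat M := by
  intro hM
  rcases h with ⟨_, _, _, _, h₁, h₂⟩ | ⟨_, _, _, _, h₁, h₂⟩ | ⟨_, _, _, _, h₁, h₂⟩ |
    ⟨_, _, _, _, h₁, h₂⟩ <;> exact h₂.sat hM (h₁.sat hM)

theorem Ext1.exists_sat {es b : List (Entry PA PK NA NK)} (h : Ext1 es b)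
    {M : AKModel PA PK NA NK} (hM : ∀ e ∈ es, e.Sat M) :
    ∃ M' : AKModel PA PK NA NK, ∀ e ∈ es ++ b, e.Sat M' := by
  classical
  have same : (∀ e ∈ b, e.Sat M) → ∃ M' : AKModel PA PK NA NK, ∀ e ∈ es ++ b, e.Sat M' :=
    fun hb => ⟨M, fun e he => (List.mem_append.1 he).elim (hM e) (hb e)⟩
  cases h with
  | refA _ _ => exact same (by simp [Entry.Sat, Entry.pf, AKSat])
  | refK _ _ => exact same (by simp [Entry.Sat, Entry.pf, AKSat])
  | negneg h => exact same (by simpa [Entry.Sat, Entry.pf, AKSat] using h.sat hM)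
  | and h => exact same (by simpa [Entry.Sat, Entry.pf, AKSat] using h.sat hM)
  | atA h => exact same (by simpa [Entry.Sat, Entry.pf, AKSat] using h.sat hM)
  | atK h => exact same (by simpa [Entry.Sat, Entry.pf, AKSat] using h.sat hM)
  | idA h h' =>
    have e : M.nA _ = M.nA _ := h.sat hM
    exact same (by simpa [Entry.Sat, Entry.pf, e] using hM _ h')
  | idK h h' =>
    have e : M.nK _ = M.nK _ := h.sat hM
    exact same (by simpa [Entry.Sat, Entry.pf, e] using hM _ h')
  | boxA h h' =>
    obtain ⟨x, hx, rfl⟩ := hM _ h'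
    exact same (by simpa [Entry.Sat, Entry.pf] using h.sat hM _ hx)
  | boxK h h' =>
    obtain ⟨y, hy, rfl⟩ := hM _ h'
    exact same (by simpa [Entry.Sat, Entry.pf] using h.sat hM _ hy)
  | @diaA a k φ c h hc _ =>
    obtain ⟨x, hx, hφ⟩ := hM _ h
    have old : ∀ e ∈ es, ∀ d, e.hasNomA d → Function.update M.nA c x d = M.nA d :=
      fun e he d hd => Function.update_of_ne (by rintro rfl; exact hc ⟨e, he, hd⟩) _ _
    have ha : Function.update M.nA c x a = M.nA a := old _ h a (.inl rfl)
    have hφ' := (sat_rename M (Function.update M.nA c x) M.nK φ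
      (fun d hd => old _ h d (.inr hd)) (fun _ _ => rfl) _ _).2 hφ
    refine ⟨M.rename (Function.update M.nA c x) M.nK, fun e he => ?_⟩
    simp only [List.mem_append, List.mem_cons, List.not_mem_nil, or_false] at he
    rcases he with he | rfl | rfl
    · exact (hM e he).rename _ _ (old e he) fun _ _ => rfl
    · simp only [Entry.Sat, Entry.pf, AKSat, ha]
      exact ⟨x, hx, by simp⟩
    · simpa [Entry.Sat, Entry.pf] using hφ'
  | @diaK a k φ m h hm _ =>
    obtain ⟨y, hy, hφ⟩ := hM _ h
    have old : ∀ e ∈ es, ∀ d, e.hasNomK d → Function.update M.nK m y d = M.nK d :=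
      fun e he d hd => Function.update_of_ne (by rintro rfl; exact hm ⟨e, he, hd⟩) _ _
    have hk : Function.update M.nK m y k = M.nK k := old _ h k (.inl rfl)
    have hφ' := (sat_rename M M.nA (Function.update M.nK m y) φ
      (fun _ _ => rfl) (fun d hd => old _ h d (.inr hd)) _ _).2 hφ
    refine ⟨M.rename M.nA (Function.update M.nK m y), fun e he => ?_⟩
    simp only [List.mem_append, List.mem_cons, List.not_mem_nil, or_false] at he
    rcases he with he | rfl | rfl
    · exact (hM e he).rename _ _ (fun _ _ => rfl) (old e he)
    · simp only [Entry.Sat, Entry.pf, AKSat, hk]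
      exact ⟨y, hy, by simp⟩
    · simpa [Entry.Sat, Entry.pf] using hφ'

theorem Closes.not_sat {es : List (Entry PA PK NA NK)} (h : Closes es)
    (M : AKModel PA PK NA NK) : ¬ ∀ e ∈ es, e.Sat M := by
  induction h generalizing M with
  | closed h => exact h.not_sat M
  | step h _ ih =>
    intro hM
    obtain ⟨M', hM'⟩ := h.exists_sat hM
    exact ih M' hM'
  | split h _ _ ih₁ ih₂ =>
    intro hM
    have extend {e₀ : Entry PA PK NA NK} (h₀ : e₀.Sat M) : ∀ e ∈ _ ++ [e₀], e.Sat M :=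
      fun e he => (List.mem_append.1 he).elim (hM e) fun he => List.mem_singleton.1 he ▸ h₀
    rcases h.sat hM with h₁ | h₁
    · exact ih₁ M (extend h₁)
    · exact ih₂ M (extend h₁)

/-- soundness: every formula provable in T_AK is AK-valid. -/
theorem tableau_soundness (φ : AKForm PA PK NA NK) (h : Provable φ) : AKValid φ := by
  classical
  obtain ⟨a, k, ha, hk, hc⟩ := h
  intro M x y
  by_contra hφ
  refine hc.not_sat (M.rename (Function.update M.nA a x) (Function.update M.nK k y)) ?_
  have hφ' := (sat_rename M (Function.update M.nA a x) (Function.update M.nK k y) φ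
    (fun b hb => Function.update_of_ne (by rintro rfl; exact ha hb) _ _)
    (fun l hl => Function.update_of_ne (by rintro rfl; exact hk hl) _ _) x y).not.2 hφ
  simpa [Entry.Sat, Entry.pf] using (sat_nnf _ φ _ _).2.2 hφ'
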